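/- arXiv:2311.00673 — 2 statements merged into one kernel-verified Lean document; each statement's English description precedes it below -/
import Mathlib

section
/- There exist matrices A_UIO ∈ ℝ^{n×n}, B^u_UIO ∈ ℝ^{n×m}, B^y_UIO ∈ ℝ^{n×p}, D_UIO ∈ ℝ^{n×p} such that A_UIO is Schur stable, D_UIO·C·E = E, B^u_UIO = (I − D_UIO·C)·B, and A_UIO·(I − D_UIO·C) + B^y_UIO·C = (I − D_UIO·C)·A, if and only if both of the following hold: (a) rank(C·E) = rank(E) = r, and (b) rank [zI_n − A, −E; C, 0] = n + r for all z ∈ ℂ with |z| ≥ 1. -/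
open Matrix Filter

noncomputable section

/-- A real square matrix is *Schur stable* if all of its complex eigenvalues
have modulus strictly less than `1`. -/
def SchurStable {n : ℕ} (M : Matrix (Fin n) (Fin n) ℝ) : Prop :=
  ∀ μ ∈ spectrum ℂ (M.map Complex.ofReal), ‖μ‖ < 1

/-- `(u, y, x, d)` is a trajectory of the system `Σ`:
`x(t+1) = A x(t) + B u(t) + E d(t)`, `y(t) = C x(t)`. -/
def IsSysTraj {n m p r : ℕ} (A : Matrix (Fin n) (Fin n) ℝ) (B : Matrix (Fin n) (Fin m) ℝ)
    (E : Matrix (Fin n) (Fin r) ℝ) (C : Matrix (Fin p) (Fin n) ℝ)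
    (u : ℕ → Fin m → ℝ) (y : ℕ → Fin p → ℝ) (x : ℕ → Fin n → ℝ) (d : ℕ → Fin r → ℝ) : Prop :=
  ∀ t : ℕ, x (t + 1) = A.mulVec (x t) + B.mulVec (u t) + E.mulVec (d t) ∧ y t = C.mulVec (x t)

/-- `(u, y, x̂, z)` is a trajectory of the candidate observer `Σ̂`:
`z(t+1) = A_UIO z(t) + B^u_UIO u(t) + B^y_UIO y(t)`, `x̂(t) = z(t) + D_UIO y(t)`. -/
def IsObsTraj {n m p : ℕ} (Auio : Matrix (Fin n) (Fin n) ℝ) (Bu : Matrix (Fin n) (Fin m) ℝ)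
    (By Duio : Matrix (Fin n) (Fin p) ℝ)
    (u : ℕ → Fin m → ℝ) (y : ℕ → Fin p → ℝ) (xhat : ℕ → Fin n → ℝ) (z : ℕ → Fin n → ℝ) : Prop :=
  ∀ t : ℕ, z (t + 1) = Auio.mulVec (z t) + Bu.mulVec (u t) + By.mulVec (y t) ∧
    xhat t = z t + Duio.mulVec (y t)

/-- `Σ̂` (given by `Auio, Bu, By, Duio`) is an unknown-input observer for `Σ`:
the estimation error `x - x̂` tends to `0` for every choice of initial conditions,
input signal, and unknown input. -/
def IsUIO {n m p r : ℕ} (A : Matrix (Fin n) (Fin n) ℝ) (B : Matrix (Fin n) (Fin m) ℝ)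
    (E : Matrix (Fin n) (Fin r) ℝ) (C : Matrix (Fin p) (Fin n) ℝ)
    (Auio : Matrix (Fin n) (Fin n) ℝ) (Bu : Matrix (Fin n) (Fin m) ℝ)
    (By Duio : Matrix (Fin n) (Fin p) ℝ) : Prop :=
  ∀ (u : ℕ → Fin m → ℝ) (y : ℕ → Fin p → ℝ) (x : ℕ → Fin n → ℝ) (d : ℕ → Fin r → ℝ)
    (xhat z : ℕ → Fin n → ℝ),
    IsSysTraj A B E C u y x d → IsObsTraj Auio Bu By Duio u y xhat z →
    Tendsto (fun t => x t - xhat t) atTop (nhds 0)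

/-- The set `T_Σ` of input/output/state trajectories of `Σ`. -/
def TSigma {n m p r : ℕ} (A : Matrix (Fin n) (Fin n) ℝ) (B : Matrix (Fin n) (Fin m) ℝ)
    (E : Matrix (Fin n) (Fin r) ℝ) (C : Matrix (Fin p) (Fin n) ℝ) :
    Set ((ℕ → Fin m → ℝ) × (ℕ → Fin p → ℝ) × (ℕ → Fin n → ℝ)) :=
  {w | ∃ d, IsSysTraj A B E C w.1 w.2.1 w.2.2 d}

/-- The set `T_Σ̂` of input/output/output-estimate trajectories of the observer `Σ̂`. -/
def TObs {n m p : ℕ} (Auio : Matrix (Fin n) (Fin n) ℝ) (Bu : Matrix (Fin n) (Fin m) ℝ)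
    (By Duio : Matrix (Fin n) (Fin p) ℝ) :
    Set ((ℕ → Fin m → ℝ) × (ℕ → Fin p → ℝ) × (ℕ → Fin n → ℝ)) :=
  {w | ∃ z, IsObsTraj Auio Bu By Duio w.1 w.2.1 w.2.2 z}

/-- "Past" data matrix: columns `v(0), …, v(N-1)`  (here `N = T - 1`). -/
def pastMat {k : ℕ} (N : ℕ) (v : ℕ → Fin k → ℝ) : Matrix (Fin k) (Fin N) ℝ :=
  Matrix.of fun i j => v j.val i

/-- "Future" data matrix: columns `v(1), …, v(N)`  (here `N = T - 1`). -/
def futMat {k : ℕ} (N : ℕ) (v : ℕ → Fin k → ℝ) : Matrix (Fin k) (Fin N) ℝ :=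
  Matrix.of fun i j => v (j.val + 1) i

/-- The historical data `(u_d, d_d, x_d, y_d)` on the time window `[0, N]`
(`N = T - 1`) are generated by the system `Σ`. -/
def GeneratedBy {n m p r : ℕ} (A : Matrix (Fin n) (Fin n) ℝ) (B : Matrix (Fin n) (Fin m) ℝ)
    (E : Matrix (Fin n) (Fin r) ℝ) (C : Matrix (Fin p) (Fin n) ℝ) (N : ℕ)
    (ud : ℕ → Fin m → ℝ) (dd : ℕ → Fin r → ℝ) (xd : ℕ → Fin n → ℝ) (yd : ℕ → Fin p → ℝ) :
    Prop :=
  (∀ t < N, xd (t + 1) = A.mulVec (xd t) + B.mulVec (ud t) + E.mulVec (dd t)) ∧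
  (∀ t ≤ N, yd t = C.mulVec (xd t))

/-- The triple `(A, E, C)` is *strong\* detectable*: for every trajectory of
`x(t+1) = A x(t) + E d(t)`, `y(t) = C x(t)` (zero known input),
`y(t) → 0` implies `x(t) → 0`. -/
def StrongStarDetectable {n p r : ℕ} (A : Matrix (Fin n) (Fin n) ℝ)
    (E : Matrix (Fin n) (Fin r) ℝ) (C : Matrix (Fin p) (Fin n) ℝ) : Prop :=
  ∀ (x : ℕ → Fin n → ℝ) (d : ℕ → Fin r → ℝ),
    (∀ t : ℕ, x (t + 1) = A.mulVec (x t) + E.mulVec (d t)) →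
    Tendsto (fun t => C.mulVec (x t)) atTop (nhds 0) →
    Tendsto x atTop (nhds 0)

/-- The set `T_c(u_d, y_d, x_d)` of trajectories compatible with the historical data:
for every `t`, the stacked vector `(u(t), y(t), x(t), x(t+1))` lies in the column
space of the stacked data matrix `[U_p; Y_p; X_p; X_f]`. -/
def TComp {n m p : ℕ} (N : ℕ) (Up : Matrix (Fin m) (Fin N) ℝ) (Yp : Matrix (Fin p) (Fin N) ℝ)
    (Xp Xf : Matrix (Fin n) (Fin N) ℝ) :
    Set ((ℕ → Fin m → ℝ) × (ℕ → Fin p → ℝ) × (ℕ → Fin n → ℝ)) :=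
  {w | ∀ t : ℕ, ∃ g : Fin N → ℝ, w.1 t = Up.mulVec g ∧ w.2.1 t = Yp.mulVec g ∧
    w.2.2 t = Xp.mulVec g ∧ w.2.2 (t + 1) = Xf.mulVec g}


section Helpers

open Polynomial ComplexConjugate

theorem aux_rank_full_iff {ι κ K : Type*} [Fintype ι] [Fintype κ] [Field K] (M : Matrix ι κ K) :
    M.rank = Fintype.card κ ↔ ∀ v, M *ᵥ v = 0 → v = 0 := by
  have h := LinearMap.finrank_range_add_finrank_ker M.mulVecLin
  rw [Module.finrank_fintype_fun_eq_card] at h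
  have h2 : (LinearMap.ker M.mulVecLin = ⊥) ↔ ∀ v, M *ᵥ v = 0 → v = 0 := by
    rw [LinearMap.ker_eq_bot']
    rfl
  rw [← h2, ← Submodule.finrank_eq_zero (R := K), Matrix.rank]
  omega

theorem aux_left_inverse {ι κ K : Type*} [Fintype ι] [Fintype κ] [DecidableEq ι] [DecidableEq κ]
    [Field K] (M : Matrix ι κ K) (h : ∀ v, M *ᵥ v = 0 → v = 0) :
    ∃ L : Matrix κ ι K, L * M = 1 := by
  have hk : LinearMap.ker (Matrix.toLin' M) = ⊥ := by
    rw [LinearMap.ker_eq_bot']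
    intro v hv
    exact h v (by simpa using hv)
  obtain ⟨g, hg⟩ := LinearMap.exists_leftInverse_of_injective _ hk
  refine ⟨LinearMap.toMatrix' g, ?_⟩
  have := congrArg LinearMap.toMatrix' hg
  rwa [LinearMap.toMatrix'_comp, LinearMap.toMatrix'_toLin', LinearMap.toMatrix'_id] at this

theorem aux_det {n : ℕ} (M : Matrix (Fin n) (Fin n) ℂ) (g r : Fin n → ℂ) :
    (M + vecMulVec (M *ᵥ g) r).det = M.det * (1 + r ⬝ᵥ g) := by
  have : M + vecMulVec (M *ᵥ g) r = M * (1 + replicateCol Unit g * replicateRow Unit r) := by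
    rw [mul_add, mul_one, ← vecMulVec_eq, mul_vecMulVec]
  rw [this, det_mul, det_one_add_replicateCol_mul_replicateRow]

/-- The number of unstable eigenvalues. -/
def auxCount (p : ℂ[X]) : ℕ := by
  classical
  exact (p.roots.filter (fun z => 1 ≤ ‖z‖)).card

theorem auxCount_mul {p q : ℂ[X]} (hp : p ≠ 0) (hq : q ≠ 0) :
    auxCount (p * q) = auxCount p + auxCount q := by
  unfold auxCount
  simp [roots_mul (mul_ne_zero hp hq)]

theorem auxCount_X : auxCount X = 0 := by
  unfold auxCount
  simp [Multiset.filter_singleton]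

theorem auxCount_X_sub_C {a : ℂ} (ha : 1 ≤ ‖a‖) : auxCount (X - C a) = 1 := by
  unfold auxCount
  simp [Multiset.filter_singleton, ha]

theorem aux_poly_eq {p q : ℂ[X]} (a b : ℂ)
    (h : ∀ z, z ≠ a → z ≠ b → p.eval z = q.eval z) : p = q := by
  apply eq_of_infinite_eval_eq
  apply Set.Infinite.mono (s := ({a, b} : Set ℂ)ᶜ)
  · intro z hz
    simp only [Set.mem_compl_iff, Set.mem_insert_iff, Set.mem_singleton_iff, not_or] at hz
    exact h z hz.1 hz.2
  · exact (Set.toFinite _).infinite_compl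

/-- Moving one pair of eigenvalues to the origin. -/
theorem aux_charpoly {n : ℕ} (F : Matrix (Fin n) (Fin n) ℝ) (r : Fin n → ℝ) (l : ℂ)
    (x : Fin n → ℂ) (hx : F.map Complex.ofReal *ᵥ x = l • x)
    (γ : ℂ) (hb : (fun j => (r j : ℂ)) ⬝ᵥ x ≠ 0) :
    ∃ g : Fin n → ℝ, ∀ z, z ≠ l → z ≠ conj l →
      ((F - vecMulVec g r).map Complex.ofReal).charpoly.eval z =
        (F.map Complex.ofReal).charpoly.eval z * (1 + (γ / (z - l) + conj γ / (z - conj l))) := by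
  set ρ : Fin n → ℂ := fun j => (r j : ℂ) with hρ
  set β := ρ ⬝ᵥ x with hβ
  set c := γ / β with hc
  refine ⟨fun j => 2 * (c * x j).re, fun z hz hz' => ?_⟩
  have hx' : F.map Complex.ofReal *ᵥ (fun j => conj (x j)) = conj l • (fun j => conj (x j)) := by
    funext i
    have := congrArg conj (congrFun hx i)
    simpa [mulVec, dotProduct] using this
  have hβ' : ρ ⬝ᵥ (fun j => conj (x j)) = conj β := by
    simp [hβ, hρ, dotProduct]
  have h1 : z - l ≠ 0 := sub_ne_zero.2 hz
  have h2 : z - conj l ≠ 0 := sub_ne_zero.2 hz'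
  set M : Matrix (Fin n) (Fin n) ℂ := scalar (Fin n) z - F.map Complex.ofReal with hM
  set g' : Fin n → ℂ := (c / (z - l)) • x + (conj c / (z - conj l)) • (fun j => conj (x j)) with hg'
  have hg : M *ᵥ g' = fun j => ((2 * (c * x j).re : ℝ) : ℂ) := by
    have hs : ∀ v : Fin n → ℂ, scalar (Fin n) z *ᵥ v = z • v := by
      intro v; rw [scalar_apply, ← smul_one_eq_diagonal, smul_mulVec, one_mulVec]
    funext j
    rw [← Complex.add_conj, hg', hM, mulVec_add, mulVec_smul, mulVec_smul, sub_mulVec, sub_mulVec,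
      hx, hx', hs, hs]
    simp only [Pi.add_apply, Pi.smul_apply, Pi.sub_apply, smul_eq_mul, map_mul]
    field_simp
  have hd : ρ ⬝ᵥ g' = γ / (z - l) + conj γ / (z - conj l) := by
    have hb' : conj β ≠ 0 := by simpa using hb
    rw [hg', dotProduct_add, dotProduct_smul, dotProduct_smul, hβ', ← hβ, hc]
    simp only [smul_eq_mul, map_div₀]
    field_simp
  rw [eval_charpoly, eval_charpoly, ← hd, ← aux_det, hg]
  congr 1
  ext i j
  simp [hM, vecMulVec, hρ, map_apply]
  ring

theorem aux_step {n : ℕ} (F : Matrix (Fin n) (Fin n) ℝ) (r : Fin n → ℝ) (l : ℂ) (hl : 1 ≤ ‖l‖)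
    (x : Fin n → ℂ) (hx : F.map Complex.ofReal *ᵥ x = l • x)
    (hb : (fun j => (r j : ℂ)) ⬝ᵥ x ≠ 0) :
    ∃ g : Fin n → ℝ, auxCount ((F - vecMulVec g r).map Complex.ofReal).charpoly <
      auxCount (F.map Complex.ofReal).charpoly := by
  have hX : (X : ℂ[X]) ≠ 0 := X_ne_zero
  by_cases hr : conj l = l
  · obtain ⟨g, hg⟩ := aux_charpoly F r l x hx (l / 2) hb
    refine ⟨g, ?_⟩
    have key : ((F - vecMulVec g r).map Complex.ofReal).charpoly * (X - C l) =
        (F.map Complex.ofReal).charpoly * X := by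
      apply aux_poly_eq l (conj l)
      intro z hz hz'
      have h1 : z - l ≠ 0 := sub_ne_zero.2 hz
      rw [eval_mul, eval_mul, hg z hz hz']
      simp only [eval_sub, eval_X, eval_C, map_div₀, hr, map_ofNat]
      field_simp
      ring
    have := congrArg auxCount key
    rw [auxCount_mul (charpoly_monic _).ne_zero (X_sub_C_ne_zero _),
      auxCount_mul (charpoly_monic _).ne_zero hX, auxCount_X, auxCount_X_sub_C hl] at this
    omega
  · obtain ⟨g, hg⟩ := aux_charpoly F r l x hx (l ^ 2 / (l - conj l)) hb
    refine ⟨g, ?_⟩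
    have key : ((F - vecMulVec g r).map Complex.ofReal).charpoly * ((X - C l) * (X - C (conj l))) =
        (F.map Complex.ofReal).charpoly * (X * X) := by
      apply aux_poly_eq l (conj l)
      intro z hz hz'
      have h1 : z - l ≠ 0 := sub_ne_zero.2 hz
      have h2 : z - conj l ≠ 0 := sub_ne_zero.2 hz'
      have h3 : l - conj l ≠ 0 := sub_ne_zero.2 (Ne.symm hr)
      have h4 : conj l - l = -(l - conj l) := by ring
      rw [eval_mul, eval_mul, hg z hz hz']
      simp only [eval_sub, eval_X, eval_C, eval_mul, map_div₀, map_sub, map_pow, Complex.conj_conj,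
        h4, div_neg]
      field_simp
      ring
    have := congrArg auxCount key
    rw [auxCount_mul (charpoly_monic _).ne_zero (mul_ne_zero (X_sub_C_ne_zero _) (X_sub_C_ne_zero _)),
      auxCount_mul (charpoly_monic _).ne_zero (mul_ne_zero hX hX), auxCount_mul hX hX,
      auxCount_mul (X_sub_C_ne_zero _) (X_sub_C_ne_zero _), auxCount_X, auxCount_X_sub_C hl,
      auxCount_X_sub_C (by simpa using hl)] at this
    omega

theorem aux_map_mul {a b c : ℕ} (M : Matrix (Fin a) (Fin b) ℝ) (N : Matrix (Fin b) (Fin c) ℝ) :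
    (M * N).map Complex.ofReal = M.map Complex.ofReal * N.map Complex.ofReal :=
  Matrix.map_mul (f := Complex.ofRealHom)

theorem aux_map_sub {a b : ℕ} (M N : Matrix (Fin a) (Fin b) ℝ) :
    (M - N).map Complex.ofReal = M.map Complex.ofReal - N.map Complex.ofReal := by
  ext; simp

theorem aux_map_add {a b : ℕ} (M N : Matrix (Fin a) (Fin b) ℝ) :
    (M + N).map Complex.ofReal = M.map Complex.ofReal + N.map Complex.ofReal := by
  ext; simp

theorem aux_map_one {a : ℕ} :
    (1 : Matrix (Fin a) (Fin a) ℝ).map Complex.ofReal = 1 := by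
  simp

theorem aux_eigen {n : ℕ} (M : Matrix (Fin n) (Fin n) ℂ) (l : ℂ) :
    l ∈ spectrum ℂ M ↔ ∃ x, x ≠ 0 ∧ M *ᵥ x = l • x := by
  rw [mem_spectrum_iff_isRoot_charpoly, IsRoot, eval_charpoly, ← exists_mulVec_eq_zero_iff]
  refine exists_congr fun x => and_congr_right fun _ => ?_
  rw [sub_mulVec, scalar_apply, ← smul_one_eq_diagonal, smul_mulVec, one_mulVec, sub_eq_zero, eq_comm]

/-- Detectability in the Hautus sense implies existence of a stabilizing output injection. -/
theorem aux_stabilize {n p : ℕ} (C : Matrix (Fin p) (Fin n) ℝ) (N : ℕ) :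
    ∀ F : Matrix (Fin n) (Fin n) ℝ, auxCount (F.map Complex.ofReal).charpoly ≤ N →
    (∀ (z : ℂ) (x : Fin n → ℂ), 1 ≤ ‖z‖ → F.map Complex.ofReal *ᵥ x = z • x →
      C.map Complex.ofReal *ᵥ x = 0 → x = 0) →
    ∃ K : Matrix (Fin n) (Fin p) ℝ, SchurStable (F - K * C) := by
  induction N with
  | zero =>
    intro F hF _
    refine ⟨0, ?_⟩
    rw [Matrix.zero_mul, sub_zero]
    intro μ hμ
    by_contra hcon
    rw [mem_spectrum_iff_isRoot_charpoly] at hμ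
    have hm := (mem_roots (charpoly_monic (F.map Complex.ofReal)).ne_zero).2 hμ
    classical
    have : μ ∈ (F.map Complex.ofReal).charpoly.roots.filter (fun z => 1 ≤ ‖z‖) :=
      Multiset.mem_filter.2 ⟨hm, not_lt.1 hcon⟩
    have h0 := Multiset.card_pos_iff_exists_mem.2 ⟨μ, this⟩
    unfold auxCount at hF
    have : 0 < 0 := lt_of_lt_of_le (by convert h0) hF
    exact lt_irrefl _ this
  | succ N ih =>
    intro F hF hdet
    by_cases hS : SchurStable F
    · exact ⟨0, by rwa [Matrix.zero_mul, sub_zero]⟩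
    · unfold SchurStable at hS
      push Not at hS
      obtain ⟨l, hl, hl1⟩ := hS
      obtain ⟨x, hx0, hx⟩ := (aux_eigen _ _).1 hl
      have hC : C.map Complex.ofReal *ᵥ x ≠ 0 := fun h => hx0 (hdet l x hl1 hx h)
      obtain ⟨i, hi⟩ := Function.ne_iff.1 hC
      obtain ⟨g, hg⟩ := aux_step F (fun j => C i j) l hl1 x hx hi
      set K₀ : Matrix (Fin n) (Fin p) ℝ := vecMulVec g (Pi.single i 1) with hK₀
      have hK : vecMulVec g (fun j => C i j) = K₀ * C := by
        rw [hK₀, vecMulVec_mul, single_one_vecMul]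
        rfl
      rw [hK] at hg
      obtain ⟨K₁, hK₁⟩ := ih (F - K₀ * C) (by omega) (by
        intro z x hz h1 h2
        refine hdet z x hz ?_ h2
        rwa [aux_map_sub, aux_map_mul, sub_mulVec, ← mulVec_mulVec, h2, mulVec_zero, sub_zero] at h1)
      refine ⟨K₀ + K₁, ?_⟩
      rwa [Matrix.add_mul, ← sub_sub]

end Helpers

/-- Matrices `A_UIO, B^u_UIO, B^y_UIO, D_UIO` with `A_UIO` Schur
stable satisfying the UIO conditions exist if and only if (a) `rank(CE) = rank(E) = r`
and (b) `rank [zI - A, -E; C, 0] = n + r` for all `z ∈ ℂ` with `|z| ≥ 1`. -/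
theorem statement2 {n m p r : ℕ}
    (A : Matrix (Fin n) (Fin n) ℝ) (B : Matrix (Fin n) (Fin m) ℝ)
    (E : Matrix (Fin n) (Fin r) ℝ) (C : Matrix (Fin p) (Fin n) ℝ)
    (hE : E.rank = r) :
    (∃ (Auio : Matrix (Fin n) (Fin n) ℝ) (Bu : Matrix (Fin n) (Fin m) ℝ)
      (By Duio : Matrix (Fin n) (Fin p) ℝ),
      SchurStable Auio ∧ Duio * C * E = E ∧ Bu = (1 - Duio * C) * B ∧
      Auio * (1 - Duio * C) + By * C = (1 - Duio * C) * A) ↔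
    (((C * E).rank = r ∧ E.rank = r) ∧
      (∀ z : ℂ, 1 ≤ ‖z‖ →
        (Matrix.fromBlocks
          (z • (1 : Matrix (Fin n) (Fin n) ℂ) - A.map Complex.ofReal)
          (-(E.map Complex.ofReal)) (C.map Complex.ofReal) 0).rank = n + r)) := by
  have hcard : ∀ z : ℂ, (Matrix.fromBlocks
          (z • (1 : Matrix (Fin n) (Fin n) ℂ) - A.map Complex.ofReal)
          (-(E.map Complex.ofReal)) (C.map Complex.ofReal) 0).rank = n + r ↔
      ∀ (x : Fin n → ℂ) (w : Fin r → ℂ),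
        z • x - A.map Complex.ofReal *ᵥ x = E.map Complex.ofReal *ᵥ w →
        C.map Complex.ofReal *ᵥ x = 0 → x = 0 ∧ w = 0 := by
    intro z
    have h := aux_rank_full_iff (Matrix.fromBlocks
          (z • (1 : Matrix (Fin n) (Fin n) ℂ) - A.map Complex.ofReal)
          (-(E.map Complex.ofReal)) (C.map Complex.ofReal)
          (0 : Matrix (Fin p) (Fin r) ℂ))
    rw [Fintype.card_sum, Fintype.card_fin, Fintype.card_fin] at h
    rw [h]
    constructor
    · intro H x w h1 h2
      have h3 := H (Sum.elim x w) (by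
        rw [fromBlocks_mulVec]
        simp only [Sum.elim_comp_inl, Sum.elim_comp_inr]
        rw [sub_mulVec, smul_mulVec, one_mulVec, h1, neg_mulVec, h2, zero_mulVec]
        ext (i | i) <;> simp)
      exact ⟨funext fun i => congrFun h3 (Sum.inl i), funext fun i => congrFun h3 (Sum.inr i)⟩
    · intro H v hv
      rw [fromBlocks_mulVec] at hv
      obtain ⟨h1, h2⟩ := H (v ∘ Sum.inl) (v ∘ Sum.inr) (by
        have : _ = (0 : Fin n → ℂ) := funext fun i => congrFun hv (Sum.inl i)
        simp only [Sum.elim_inl] at this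
        have h5 : (z • (1 : Matrix (Fin n) (Fin n) ℂ) - A.map Complex.ofReal) *ᵥ (v ∘ Sum.inl) +
          (-(E.map Complex.ofReal)) *ᵥ (v ∘ Sum.inr) = 0 := this
        rwa [sub_mulVec, smul_mulVec, one_mulVec, neg_mulVec, ← sub_eq_add_neg, sub_eq_zero] at h5) (by
        have : C.map Complex.ofReal *ᵥ (v ∘ Sum.inl) +
          (0 : Matrix (Fin p) (Fin r) ℂ) *ᵥ (v ∘ Sum.inr) = 0 :=
            funext fun i => congrFun hv (Sum.inr i)
        rwa [zero_mulVec, add_zero] at this)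
      ext (i | i)
      · exact congrFun h1 i
      · exact congrFun h2 i
  constructor
  · rintro ⟨Auio, Bu, By, D, hS, hD, -, hA⟩
    refine ⟨⟨le_antisymm (by simpa using rank_le_card_width (C * E)) ?_, hE⟩, fun z hz => ?_⟩
    · calc r = (D * (C * E)).rank := by rw [← Matrix.mul_assoc, hD, hE]
        _ ≤ (C * E).rank := rank_mul_le_right _ _
    · rw [hcard]
      intro x w h1 h2
      obtain ⟨L, hL⟩ := aux_left_inverse E ((aux_rank_full_iff E).1 (by simpa using hE))
      have hx : x = 0 := by
        by_contra hx
        refine absurd (hS z ((aux_eigen _ _).2 ⟨x, hx, ?_⟩)) (not_lt.2 hz)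
        have hA' := congrArg (fun M => M.map Complex.ofReal *ᵥ x) hA
        have hP : ((1 - D * C).map Complex.ofReal) *ᵥ x = x := by
          rw [aux_map_sub, aux_map_one, aux_map_mul, sub_mulVec, ← mulVec_mulVec, h2, mulVec_zero,
            one_mulVec, sub_zero]
        have hPE : ((1 - D * C).map Complex.ofReal) *ᵥ (E.map Complex.ofReal *ᵥ w) = 0 := by
          rw [mulVec_mulVec, ← aux_map_mul, Matrix.sub_mul, Matrix.one_mul, hD, sub_self]
          ext; simp [mulVec, dotProduct]
        simp only [aux_map_add] at hA'
        rw [aux_map_mul, aux_map_mul, aux_map_mul _ A, add_mulVec, ← mulVec_mulVec, ← mulVec_mulVec,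
          ← mulVec_mulVec, h2, hP, mulVec_zero, add_zero] at hA'
        rw [← h1, mulVec_sub, mulVec_smul, hP, sub_eq_zero] at hPE
        rw [hA', hPE]
      refine ⟨hx, ?_⟩
      have h3 : E.map Complex.ofReal *ᵥ w = 0 := by rw [← h1, hx]; simp
      have h4 := congrArg (fun v => L.map Complex.ofReal *ᵥ v) h3
      simpa [mulVec_mulVec, ← aux_map_mul, hL] using h4
  · rintro ⟨⟨hCE, -⟩, hz⟩
    obtain ⟨L, hL⟩ := aux_left_inverse (C * E) ((aux_rank_full_iff _).1 (by simpa using hCE))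
    set D := E * L with hD
    obtain ⟨K, hK⟩ := aux_stabilize C _ ((1 - D * C) * A) le_rfl (by
      intro z x h1 h2 h3
      have hP : ((1 - D * C).map Complex.ofReal) *ᵥ x = x := by
        rw [aux_map_sub, aux_map_one, aux_map_mul, sub_mulVec, ← mulVec_mulVec, h3, mulVec_zero,
          one_mulVec, sub_zero]
      refine ((hcard z).1 (hz z h1) x ((L * C).map Complex.ofReal *ᵥ
        (z • x - A.map Complex.ofReal *ᵥ x)) ?_ h3).1
      rw [aux_map_mul, ← mulVec_mulVec] at h2
      have h5 : ((1 - D * C).map Complex.ofReal) *ᵥ (z • x - A.map Complex.ofReal *ᵥ x) = 0 := by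
        rw [mulVec_sub, h2, mulVec_smul, hP, sub_self]
      rw [aux_map_sub, aux_map_one, sub_mulVec, one_mulVec, sub_eq_zero] at h5
      rw [mulVec_mulVec, ← aux_map_mul, ← Matrix.mul_assoc, ← hD]
      exact h5)
    refine ⟨(1 - D * C) * A - K * C, _, (1 - D * C) * A * D + K - K * C * D, D, hK, ?_, rfl, ?_⟩
    · rw [hD, Matrix.mul_assoc, Matrix.mul_assoc, hL, Matrix.mul_one]
    · simp only [Matrix.mul_sub, Matrix.sub_mul, Matrix.add_mul, Matrix.mul_one, Matrix.one_mul,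
        Matrix.mul_assoc]
      abel
end
end

section
/- Suppose the historical data are generated by the system Σ and the Assumption holds (the stacked matrix [U_p; D_p; X_p] has full row rank m + r + n). Then there exists an unknown-input observer Σ̂ of the observer form for Σ with T_Σ ⊆ T_Σ̂ if and only if both of the following data conditions hold: ker(X_f) ⊇ ker([U_p; Y_p; Y_f; X_p]), and rank [z·X_p − X_f; U_p; Y_p] = n + m + r for all z ∈ ℂ with |z| ≥ 1. -/
open Matrix Filter

noncomputable section

/-- states that can be steered to zero exponentially -/
def expStab {V U : Type*} [NormedAddCommGroup V] [NormedSpace ℂ V]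
    [NormedAddCommGroup U] [NormedSpace ℂ U]
    (A : V →ₗ[ℂ] V) (B : U →ₗ[ℂ] V) : Submodule ℂ V where
  carrier := {x | ∃ (c ρ : ℝ) (xs : ℕ → V) (us : ℕ → U), 0 < ρ ∧ ρ < 1 ∧ 0 ≤ c ∧ xs 0 = x ∧
    (∀ t, xs (t+1) = A (xs t) + B (us t)) ∧ (∀ t, ‖xs t‖ ≤ c * ρ^t) ∧ (∀ t, ‖us t‖ ≤ c * ρ^t)}
  zero_mem' := ⟨0, 1/2, fun _ => 0, fun _ => 0, by norm_num, by norm_num, le_rfl, rfl,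
    by simp, by simp, by simp⟩
  add_mem' := by
    rintro x y ⟨c, ρ, xs, us, h0, h1, hc, hx, hd, hbx, hbu⟩
      ⟨c', ρ', xs', us', h0', h1', hc', hx', hd', hbx', hbu'⟩
    have key : ∀ t, c * ρ^t + c' * ρ'^t ≤ (c + c') * (max ρ ρ')^t := by
      intro t
      have e1 : ρ^t ≤ (max ρ ρ')^t := pow_le_pow_left₀ h0.le (le_max_left _ _) t
      have e2 : ρ'^t ≤ (max ρ ρ')^t := pow_le_pow_left₀ h0'.le (le_max_right _ _) t
      nlinarith [mul_le_mul_of_nonneg_left e1 hc, mul_le_mul_of_nonneg_left e2 hc']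
    refine ⟨c + c', max ρ ρ', fun t => xs t + xs' t, fun t => us t + us' t,
      lt_max_of_lt_left h0, max_lt h1 h1', by positivity, by simp [hx, hx'], ?_, ?_, ?_⟩
    · intro t; simp only [hd, hd', map_add]; abel
    · intro t
      exact ((norm_add_le _ _).trans (add_le_add (hbx t) (hbx' t))).trans (key t)
    · intro t
      exact ((norm_add_le _ _).trans (add_le_add (hbu t) (hbu' t))).trans (key t)
  smul_mem' := by
    rintro a x ⟨c, ρ, xs, us, h0, h1, hc, hx, hd, hbx, hbu⟩
    refine ⟨‖a‖ * c, ρ, fun t => a • xs t, fun t => a • us t, h0, h1, by positivity,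
      by simp [hx], ?_, ?_, ?_⟩
    · intro t; simp only [hd, map_smul, smul_add]
    · intro t; rw [norm_smul, mul_assoc]; exact mul_le_mul_of_nonneg_left (hbx t) (norm_nonneg _)
    · intro t; rw [norm_smul, mul_assoc]; exact mul_le_mul_of_nonneg_left (hbu t) (norm_nonneg _)

section
variable {V U : Type*} [NormedAddCommGroup V] [NormedSpace ℂ V]
    [NormedAddCommGroup U] [NormedSpace ℂ U]
    (A : V →ₗ[ℂ] V) (B : U →ₗ[ℂ] V)

lemma expStab_back (x : V) (u : U) (h : A x + B u ∈ expStab A B) : x ∈ expStab A B := by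
  obtain ⟨c, ρ, xs, us, h0, h1, hc, hx, hd, hbx, hbu⟩ := h
  refine ⟨max (max ‖x‖ ‖u‖) (c / ρ), ρ, fun t => Nat.casesOn t x xs, fun t => Nat.casesOn t u us,
    h0, h1, by positivity, rfl, ?_, ?_, ?_⟩
  · intro t; cases t with
    | zero => exact hx
    | succ t => exact hd t
  · intro t; cases t with
    | zero => simp
    | succ t =>
      refine (hbx t).trans ?_
      have : c * ρ^t = c / ρ * ρ^(t+1) := by field_simp; ring
      rw [this]
      exact mul_le_mul_of_nonneg_right (le_max_right _ _) (by positivity)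
  · intro t; cases t with
    | zero => simp
    | succ t =>
      refine (hbu t).trans ?_
      have : c * ρ^t = c / ρ * ρ^(t+1) := by field_simp; ring
      rw [this]
      exact mul_le_mul_of_nonneg_right (le_max_right _ _) (by positivity)

lemma expStab_fwd (x : V) (h : x ∈ expStab A B) : ∃ u, A x + B u ∈ expStab A B := by
  obtain ⟨c, ρ, xs, us, h0, h1, hc, hx, hd, hbx, hbu⟩ := h
  refine ⟨us 0, c * ρ, ρ, fun t => xs (t+1), fun t => us (t+1), h0, h1, by positivity, ?_, ?_, ?_, ?_⟩
  · simp [hd, hx]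
  · intro t; exact hd _
  · intro t; refine (hbx _).trans (le_of_eq ?_); ring
  · intro t; refine (hbu _).trans (le_of_eq ?_); ring

lemma conv_bound {W : Type*} [NormedAddCommGroup W] [NormedSpace ℂ W] (l : ℂ) (c ρ : ℝ)
    (h : ‖l‖ < ρ) (hc : 0 ≤ c) (w s : ℕ → W) (hs : ∀ t, ‖s t‖ ≤ c * ρ^t) (h0 : w 0 = 0)
    (hw : ∀ t, w (t+1) = l • w t + s t) : ∀ t, ‖w t‖ ≤ c / (ρ - ‖l‖) * ρ^t := by
  have hp : 0 < ρ - ‖l‖ := sub_pos.2 h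
  intro t
  induction t with
  | zero => simp only [h0, norm_zero]; positivity
  | succ t ih =>
    rw [hw]
    calc ‖l • w t + s t‖ ≤ ‖l‖ * ‖w t‖ + ‖s t‖ := by
          rw [← norm_smul]; exact norm_add_le _ _
      _ ≤ ‖l‖ * (c / (ρ - ‖l‖) * ρ^t) + c * ρ^t :=
          add_le_add (mul_le_mul_of_nonneg_left ih (norm_nonneg _)) (hs t)
      _ = _ := by field_simp; ring

lemma expStab_eig (x s : V) (l : ℂ) (hl : ‖l‖ < 1) (h : s ∈ expStab A B)
    (hx : A x = l • x + s) : x ∈ expStab A B := by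
  obtain ⟨c, ρ, xs, us, h0, h1, hc, hxs, hd, hbx, hbu⟩ := h
  obtain ⟨σ, hσ1, hσ2⟩ := exists_between (max_lt h1 hl)
  have hρσ : ρ < σ := (le_max_left _ _).trans_lt hσ1
  have hlσ : ‖l‖ < σ := (le_max_right _ _).trans_lt hσ1
  have hpw : ∀ t, c * ρ^t ≤ c * σ^t := fun t =>
    mul_le_mul_of_nonneg_left (pow_le_pow_left₀ h0.le hρσ.le t) hc
  let w : ℕ → V := fun t => Nat.rec 0 (fun k a => l • a + xs k) t
  let v : ℕ → U := fun t => Nat.rec 0 (fun k a => l • a + us k) t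
  have hw : ∀ t, w (t+1) = l • w t + xs t := fun t => rfl
  have hv : ∀ t, v (t+1) = l • v t + us t := fun t => rfl
  have bw := conv_bound l c σ hlσ hc w xs (fun t => (hbx t).trans (hpw t)) rfl hw
  have bv := conv_bound l c σ hlσ hc v us (fun t => (hbu t).trans (hpw t)) rfl hv
  have hp : 0 < σ - ‖l‖ := sub_pos.2 hlσ
  have hσ0 : 0 < σ := h0.trans hρσ
  have key : ∀ t, w (t+1) = A (w t) + l^t • s + B (v t) := by
    intro t
    induction t with
    | zero => simp [w, v, hxs]
    | succ t ih =>
      rw [hw (t+1), hd t, hw t, hv t]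
      conv_lhs => rw [← hw t, ih]
      simp only [map_add, map_smul, smul_add, pow_succ', mul_smul]
      abel
  refine ⟨‖x‖ + c / (σ - ‖l‖), σ, fun t => l^t • x + w t, v, hσ0, hσ2, by positivity, ?_, ?_, ?_, ?_⟩
  · simp [w]
  · intro t
    simp only [key t, map_add, map_smul, hx, smul_add, pow_succ, mul_smul]
    abel
  · intro t
    rw [add_mul]
    refine (norm_add_le _ _).trans (add_le_add ?_ (bw t))
    rw [norm_smul, norm_pow, mul_comm]
    exact mul_le_mul_of_nonneg_left (pow_le_pow_left₀ (norm_nonneg _) hlσ.le t) (norm_nonneg _)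
  · intro t
    refine (bv t).trans (mul_le_mul_of_nonneg_right ?_ (by positivity))
    linarith [norm_nonneg x]

lemma expStab_top [FiniteDimensional ℂ V]
    (hP : ∀ l : ℂ, 1 ≤ ‖l‖ → ∀ y, ∃ x u, A x - l • x + B u = y) : expStab A B = ⊤ := by
  set S := expStab A B with hS
  have hle : S ≤ (S ⊔ LinearMap.range B).comap A := by
    intro x hx
    obtain ⟨u, hu⟩ := expStab_fwd A B x hx
    rw [Submodule.mem_comap]
    have : A x = (A x + B u) + B (-u) := by simp
    rw [this]
    exact Submodule.add_mem_sup hu ⟨_, rfl⟩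
  let f : (V ⧸ S) →ₗ[ℂ] (V ⧸ (S ⊔ LinearMap.range B)) := S.mapQ _ A hle
  have hf : Function.Injective f := by
    rw [← LinearMap.ker_eq_bot, LinearMap.ker_eq_bot']
    intro q hq
    obtain ⟨x, rfl⟩ := S.mkQ_surjective q
    simp only [f, Submodule.mkQ_apply, Submodule.mapQ_apply, Submodule.Quotient.mk_eq_zero] at hq ⊢
    obtain ⟨s, hs, _, ⟨u, rfl⟩, hsu⟩ := Submodule.mem_sup.1 hq
    refine expStab_back A B x (-u) ?_
    rw [← hsu]; simpa using hs
  have hd := LinearMap.finrank_le_finrank_of_injective hf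
  have e1 := Submodule.finrank_quotient_add_finrank S
  have e2 := Submodule.finrank_quotient_add_finrank (S ⊔ LinearMap.range B)
  have hSB : S = S ⊔ LinearMap.range B :=
    Submodule.eq_of_le_of_finrank_le le_sup_left (by omega)
  have hB : ∀ u, B u ∈ S := fun u => by
    rw [hSB]; exact (le_sup_right : LinearMap.range B ≤ _) ⟨u, rfl⟩
  have hA : S ≤ S.comap A := by
    intro x hx
    have := hle hx
    rwa [← hSB] at this
  by_contra hne
  have : Nontrivial (V ⧸ S) := Submodule.Quotient.nontrivial_iff.2 hne
  let Q : Module.End ℂ (V ⧸ S) := S.mapQ S A hA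
  obtain ⟨l, hl⟩ := Module.End.exists_eigenvalue Q
  obtain ⟨q, hq⟩ := hl.exists_hasEigenvector
  have hq0 := hq.2
  have hql : Q q = l • q := hq.apply_eq_smul
  obtain ⟨x, rfl⟩ := S.mkQ_surjective q
  by_cases hl1 : ‖l‖ < 1
  · apply hq0
    have : A x - l • x ∈ S := by
      rw [← Submodule.Quotient.mk_eq_zero]
      simpa [Q, sub_eq_zero] using hql
    have := expStab_eig A B x (A x - l • x) l hl1 this (by abel)
    simpa using this
  · have hsurj : Function.Surjective (Q - l • (1 : Module.End ℂ (V ⧸ S))) := by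
      intro y
      obtain ⟨y, rfl⟩ := S.mkQ_surjective y
      obtain ⟨x, u, hxu⟩ := hP l (not_lt.1 hl1) y
      refine ⟨S.mkQ x, ?_⟩
      have : S.mkQ (B u) = 0 := by simpa using hB u
      rw [← hxu, map_add, this]
      simp [Q]
    have hinj := LinearMap.injective_iff_surjective.2 hsurj
    apply hq0
    apply hinj
    simpa [sub_eq_zero] using hql
end
section
variable {W X : Type*} [NormedAddCommGroup W] [InnerProductSpace ℝ W]
  [NormedAddCommGroup X] [NormedSpace ℝ X] (P G : W →L[ℝ] X)

/-- evaluation of a square-summable signal -/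
def evl2 (W : Type*) [NormedAddCommGroup W] [InnerProductSpace ℝ W] (t : ℕ) :
    lp (fun _ : ℕ => W) 2 →L[ℝ] W :=
  LinearMap.mkContinuous
    { toFun := fun f => f t, map_add' := fun _ _ => rfl, map_smul' := fun _ _ => rfl } 1
    (fun f => by rw [one_mul]; exact lp.norm_apply_le_norm (by norm_num) f t)

@[simp] lemma evl2_apply (t : ℕ) (f : lp (fun _ : ℕ => W) 2) : evl2 W t f = f t := rfl

lemma memℓ2_iff (f : ℕ → W) : Memℓp f 2 ↔ Summable fun i => ‖f i‖^2 := by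
  rw [memℓp_gen_iff (by norm_num)]; simp

lemma l2_summable (f : lp (fun _ : ℕ => W) 2) : Summable fun i => ‖f i‖^2 :=
  (memℓ2_iff _).1 f.2

/-- square-summable behaviour -/
def bhv : Submodule ℝ (lp (fun _ : ℕ => W) 2) where
  carrier := {f | ∀ t, P (f (t+1)) = G (f t)}
  zero_mem' := by intro t; simp
  add_mem' := by intro f g hf hg t; simp [hf t, hg t]
  smul_mem' := by intro c f hf t; simp [hf t]

/-- square-summable behaviour with zero initial state -/
def bhv0 : Submodule ℝ (lp (fun _ : ℕ => W) 2) where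
  carrier := {f | (∀ t, P (f (t+1)) = G (f t)) ∧ P (f 0) = 0}
  zero_mem' := by simp
  add_mem' := by rintro f g ⟨hf, hf0⟩ ⟨hg, hg0⟩; exact ⟨fun t => by simp [hf t, hg t], by simp [*]⟩
  smul_mem' := by rintro c f ⟨hf, hf0⟩; exact ⟨fun t => by simp [hf t], by simp [*]⟩

lemma bhv0_closed : IsClosed (bhv0 P G : Set (lp (fun _ : ℕ => W) 2)) := by
  have : (bhv0 P G : Set (lp (fun _ : ℕ => W) 2)) =
      (⋂ t, {f | P (evl2 W (t+1) f) = G (evl2 W t f)}) ∩ {f | P (evl2 W 0 f) = 0} := by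
    ext f; simp [bhv0]
  rw [this]
  refine IsClosed.inter (isClosed_iInter fun t => isClosed_eq ?_ ?_) (isClosed_eq ?_ ?_) <;> fun_prop

/-- the tail of a signal -/
def tl2 (f : lp (fun _ : ℕ => W) 2) : lp (fun _ : ℕ => W) 2 :=
  ⟨fun t => f (t+1), (memℓ2_iff _).2 ((summable_nat_add_iff 1).2 (l2_summable f))⟩

/-- prepend zero -/
def cons2 (f : lp (fun _ : ℕ => W) 2) : lp (fun _ : ℕ => W) 2 :=
  ⟨fun t => Nat.casesOn t 0 (fun k => f k),
    (memℓ2_iff _).2 ((summable_nat_add_iff 1).1 (by simpa using (l2_summable f)))⟩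

lemma inner_cons2 (f k : lp (fun _ : ℕ => W) 2) :
    inner ℝ (cons2 k) f = inner ℝ k (tl2 f) := by
  rw [lp.inner_eq_tsum, lp.inner_eq_tsum, (lp.summable_inner (𝕜 := ℝ) (cons2 k) f).tsum_eq_zero_add]
  simp [cons2, tl2]

lemma optimal_feedback [CompleteSpace W]
    (H : ∀ x : X, ∃ f : ℕ → W, P (f 0) = x ∧ (∀ t, P (f (t+1)) = G (f t)) ∧
      Summable fun t => ‖f t‖^2) :
    ∃ R : X →ₗ[ℝ] W, (∀ x, P (R x) = x) ∧
      ∀ x : X, Tendsto (fun t : ℕ => ((G.toLinearMap ∘ₗ R)^t) x) atTop (nhds 0) := by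
  have : CompleteSpace (bhv0 P G) := (bhv0_closed P G).completeSpace_coe
  let O : Submodule ℝ (lp (fun _ : ℕ => W) 2) := bhv P G ⊓ (bhv0 P G)ᗮ
  let e : O →ₗ[ℝ] X := P.toLinearMap ∘ₗ (evl2 W 0).toLinearMap ∘ₗ O.subtype
  have he : ∀ f : O, e f = P (f.1 0) := fun f => rfl
  have hinj : Function.Injective e := by
    rw [← LinearMap.ker_eq_bot, LinearMap.ker_eq_bot']
    rintro ⟨f, hf1, hf2⟩ h0
    have : f ∈ bhv0 P G := ⟨hf1, h0⟩
    have := hf2 f this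
    exact Subtype.ext (inner_self_eq_zero.1 this)
  have hsurj : Function.Surjective e := by
    intro x
    obtain ⟨f, hf0, hf, hs⟩ := H x
    let f' : lp (fun _ : ℕ => W) 2 := ⟨f, (memℓ2_iff _).2 hs⟩
    obtain ⟨k, hk, g, hg, hkg⟩ := (bhv0 P G).exists_add_mem_mem_orthogonal f'
    have hgk : g = f' - k := by rw [hkg]; abel
    refine ⟨⟨g, ?_, hg⟩, ?_⟩
    · rw [hgk]
      exact Submodule.sub_mem _ hf hk.1
    · change P (g 0) = x
      rw [hgk]
      change P (f 0 - k 0) = x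
      rw [map_sub, hk.2, hf0, sub_zero]
  let e' := LinearEquiv.ofBijective e ⟨hinj, hsurj⟩
  let R : X →ₗ[ℝ] W := (evl2 W 0).toLinearMap ∘ₗ O.subtype ∘ₗ e'.symm.toLinearMap
  have hR : ∀ x, R x = (e'.symm x).1 0 := fun x => rfl
  have hRe : ∀ f ∈ O, R (P (f 0)) = f 0 := by
    intro f hf
    have : e'.symm (P (f 0)) = ⟨f, hf⟩ := by
      rw [LinearEquiv.symm_apply_eq]; rfl
    rw [hR, this]
  have htl : ∀ f ∈ O, tl2 f ∈ O := by
    rintro f ⟨hf1, hf2⟩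
    refine ⟨fun t => hf1 (t+1), fun k hk => ?_⟩
    rw [← inner_cons2]
    apply hf2
    refine ⟨fun t => ?_, ?_⟩
    · cases t with
      | zero =>
        change P (k 0) = G 0
        rw [hk.2, map_zero]
      | succ t => exact hk.1 t
    · change P 0 = 0
      simp
  refine ⟨R, fun x => ?_, fun x => ?_⟩
  · rw [hR, ← he]
    exact e'.apply_symm_apply x
  · have main : ∀ t : ℕ, ∀ f ∈ O, ((G.toLinearMap ∘ₗ R)^t) (P (f 0)) = P (f t) := by
      intro t
      induction t with
      | zero => intro f hf; simp
      | succ t ih =>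
        intro f hf
        rw [pow_succ, Module.End.mul_apply]
        have : (G.toLinearMap ∘ₗ R) (P (f 0)) = P ((tl2 f) 0) := by
          change G (R (P (f 0))) = P (f 1)
          rw [hRe f hf]; exact (hf.1 0).symm
        rw [this, ih _ (htl f hf)]; rfl
    have hx : P ((e'.symm x).1 0) = x := e'.apply_symm_apply x
    have h0 : Tendsto (fun t => (e'.symm x).1 t) atTop (nhds 0) := by
      have := (l2_summable (e'.symm x).1).tendsto_atTop_zero
      rw [tendsto_zero_iff_norm_tendsto_zero]
      have h2 := this.sqrt
      simpa using h2
    have h1 := (P.continuous.tendsto 0).comp h0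
    rw [map_zero] at h1
    refine h1.congr fun t => ?_
    have := main t _ (e'.symm x).2
    rw [hx] at this
    exact this.symm
end

lemma exists_left_inv {K ι κ : Type*} [Field K] [Fintype ι] [Fintype κ] [DecidableEq ι]
    [DecidableEq κ] (Q : Matrix ι κ K)
    (h : ∀ x, Q *ᵥ x = 0 → x = 0) : ∃ L : Matrix κ ι K, L * Q = 1 := by
  obtain ⟨g, hg⟩ := LinearMap.exists_leftInverse_of_injective Q.mulVecLin
    (LinearMap.ker_eq_bot'.2 h)
  refine ⟨LinearMap.toMatrix' g, ?_⟩
  have := congrArg LinearMap.toMatrix' hg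
  rw [LinearMap.toMatrix'_comp, LinearMap.toMatrix'_id] at this
  have hQ : LinearMap.toMatrix' Q.mulVecLin = Q := LinearMap.toMatrix'_toLin' Q
  rwa [hQ] at this

lemma re_mulVec {k l : ℕ} (M : Matrix (Fin k) (Fin l) ℝ) (v : Fin l → ℂ) :
    (fun i => ((M.map Complex.ofReal) *ᵥ v) i |>.re) = M *ᵥ (fun i => (v i).re) := by
  ext i
  simp [Matrix.mulVec, dotProduct]

lemma im_mulVec {k l : ℕ} (M : Matrix (Fin k) (Fin l) ℝ) (v : Fin l → ℂ) :
    (fun i => ((M.map Complex.ofReal) *ᵥ v) i |>.im) = M *ᵥ (fun i => (v i).im) := by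
  ext i
  simp [Matrix.mulVec, dotProduct]

lemma stabilize {n p : ℕ} (M : Matrix (Fin n) (Fin n) ℝ) (C : Matrix (Fin p) (Fin n) ℝ)
    (hP : ∀ l : ℂ, 1 ≤ ‖l‖ → ∀ x : Fin n → ℂ, (M.map Complex.ofReal) *ᵥ x = l • x →
      (C.map Complex.ofReal) *ᵥ x = 0 → x = 0) :
    ∃ L : Matrix (Fin n) (Fin p) ℝ, ∀ v : Fin n → ℝ,
      Tendsto (fun t : ℕ => ((M - L * C)^t) *ᵥ v) atTop (nhds 0) := by
  let A : (Fin n → ℂ) →ₗ[ℂ] (Fin n → ℂ) := (Mᵀ.map Complex.ofReal).mulVecLin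
  let B : (Fin p → ℂ) →ₗ[ℂ] (Fin n → ℂ) := (Cᵀ.map Complex.ofReal).mulVecLin
  have htop : expStab A B = ⊤ := by
    apply expStab_top
    intro l hl y
    obtain ⟨K, hK⟩ := exists_left_inv
      (Matrix.fromRows (M.map Complex.ofReal - l • (1 : Matrix (Fin n) (Fin n) ℂ))
        (C.map Complex.ofReal)) (by
        intro x hx
        rw [Matrix.fromRows_mulVec] at hx
        have h1 := congrArg (fun f => f ∘ Sum.inl) hx
        have h2 := congrArg (fun f => f ∘ Sum.inr) hx
        simp only [Sum.elim_comp_inl, Sum.elim_comp_inr] at h1 h2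
        refine hP l hl x ?_ h2
        rw [Matrix.sub_mulVec, Matrix.smul_mulVec, Matrix.one_mulVec] at h1
        exact sub_eq_zero.1 h1)
    rw [← Matrix.fromCols_toCols K, Matrix.fromCols_mul_fromRows] at hK
    have hK' := congrArg Matrix.transpose hK
    rw [Matrix.transpose_add, Matrix.transpose_mul, Matrix.transpose_mul, Matrix.transpose_one] at hK'
    refine ⟨K.toCols₁ᵀ *ᵥ y, K.toCols₂ᵀ *ᵥ y, ?_⟩
    have := congrArg (fun Z => Z *ᵥ y) hK'
    simp only [Matrix.add_mulVec, Matrix.one_mulVec, ← Matrix.mulVec_mulVec, Matrix.transpose_sub,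
      Matrix.transpose_smul, Matrix.transpose_one, Matrix.sub_mulVec, Matrix.smul_mulVec] at this
    exact this
  let W := EuclideanSpace ℝ (Fin n ⊕ Fin p)
  let P0 : W →ₗ[ℝ] (Fin n → ℝ) :=
    { toFun := fun w i => w (Sum.inl i), map_add' := fun _ _ => rfl, map_smul' := fun _ _ => rfl }
  let P1 : W →ₗ[ℝ] (Fin p → ℝ) :=
    { toFun := fun w i => w (Sum.inr i), map_add' := fun _ _ => rfl, map_smul' := fun _ _ => rfl }
  let G0 : W →ₗ[ℝ] (Fin n → ℝ) := Mᵀ.mulVecLin ∘ₗ P0 + Cᵀ.mulVecLin ∘ₗ P1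
  obtain ⟨R, hR1, hR2⟩ := optimal_feedback (LinearMap.toContinuousLinearMap P0)
    (LinearMap.toContinuousLinearMap G0) (by
      intro x
      have hx : (fun i => (x i : ℂ)) ∈ expStab A B := by rw [htop]; trivial
      obtain ⟨c, ρ, xs, us, h0, h1, hc, hxs, hd, hbx, hbu⟩ := hx
      refine ⟨fun t => WithLp.toLp 2 (Sum.elim (fun i => (xs t i).re) (fun i => (us t i).re)),
        ?_, ?_, ?_⟩
      · change (fun i => (xs 0 i).re) = x
        rw [hxs]; rfl
      · intro t
        change (fun i => (xs (t+1) i).re) = Mᵀ *ᵥ (fun i => (xs t i).re) + Cᵀ *ᵥ (fun i => (us t i).re)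
        rw [hd, ← re_mulVec, ← re_mulVec]
        rfl
      · have hs : Summable fun t : ℕ => ((n + p : ℝ) * c^2) * (ρ^2)^t :=
          (summable_geometric_of_lt_one (by positivity) (by nlinarith)).mul_left _
        refine hs.of_nonneg_of_le (fun t => by positivity) (fun t => ?_)
        rw [EuclideanSpace.norm_sq_eq]
        have hb : ∀ i : Fin n ⊕ Fin p,
            ‖(Sum.elim (fun i => (xs t i).re) (fun i => (us t i).re) i : ℝ)‖^2 ≤ (c * ρ^t)^2 := by
          intro i
          apply pow_le_pow_left₀ (norm_nonneg _)
          cases i with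
          | inl i => exact (Complex.abs_re_le_norm _).trans ((norm_le_pi_norm _ _).trans (hbx t))
          | inr i => exact (Complex.abs_re_le_norm _).trans ((norm_le_pi_norm _ _).trans (hbu t))
        refine (Finset.sum_le_sum fun i _ => hb i).trans (le_of_eq ?_)
        simp
        ring)
  let F : Matrix (Fin p) (Fin n) ℝ := LinearMap.toMatrix' (P1 ∘ₗ R)
  have hF : ∀ x, F *ᵥ x = P1 (R x) := fun x => by
    simp [F]
  refine ⟨-Fᵀ, ?_⟩
  have hGR : (LinearMap.toContinuousLinearMap G0).toLinearMap ∘ₗ R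
      = ((M - (-Fᵀ) * C)ᵀ).mulVecLin := by
    refine LinearMap.ext fun x => ?_
    change (Mᵀ *ᵥ (P0 (R x)) + Cᵀ *ᵥ (P1 (R x))) = (M - (-Fᵀ) * C)ᵀ *ᵥ x
    rw [← hF, show P0 (R x) = x from hR1 x]
    simp [Matrix.transpose_sub, Matrix.add_mulVec, Matrix.mulVec_mulVec]
  have hpow : ∀ t : ℕ, ((M - (-Fᵀ) * C)ᵀ).mulVecLin ^ t = (((M - (-Fᵀ) * C)ᵀ)^t).mulVecLin := by
    intro t
    induction t with
    | zero => simp; rfl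
    | succ t ih => rw [pow_succ, ih, pow_succ, Matrix.mulVecLin_mul]; rfl
  have hent : ∀ i j, Tendsto (fun t : ℕ => ((M - (-Fᵀ) * C)^t) i j) atTop (nhds 0) := by
    intro i j
    have := hR2 (Pi.single i 1)
    rw [hGR] at this
    simp only [hpow] at this
    have := (tendsto_pi_nhds.1 this) j
    refine this.congr fun t => ?_
    rw [Matrix.mulVecLin_apply, Matrix.mulVec_single_one, ← Matrix.transpose_pow]
    rfl
  intro v
  rw [tendsto_pi_nhds]
  intro i
  have : Tendsto (fun t : ℕ => ∑ j, ((M - (-Fᵀ) * C)^t) i j * v j) atTop (nhds (∑ j, 0 * v j)) :=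
    tendsto_finsetSum _ fun j _ => (hent i j).mul_const _
  simp only [zero_mul, Finset.sum_const_zero] at this
  exact this

lemma map_mul_ofReal {a b c : ℕ} (M : Matrix (Fin a) (Fin b) ℝ) (K : Matrix (Fin b) (Fin c) ℝ) :
    (M * K).map Complex.ofReal = M.map Complex.ofReal * K.map Complex.ofReal :=
  Matrix.map_mul (f := Complex.ofRealHom) (L := M) (M := K)

lemma surj_of_rank {n m r N : ℕ} (U : Matrix (Fin m) (Fin N) ℝ) (D : Matrix (Fin r) (Fin N) ℝ)
    (X : Matrix (Fin n) (Fin N) ℝ)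
    (h : (Matrix.fromRows U (Matrix.fromRows D X)).rank = m + r + n) (u : Fin m → ℝ)
    (d : Fin r → ℝ) (x : Fin n → ℝ) : ∃ g, U *ᵥ g = u ∧ D *ᵥ g = d ∧ X *ᵥ g = x := by
  have htop : LinearMap.range (Matrix.fromRows U (Matrix.fromRows D X)).mulVecLin = ⊤ := by
    apply Submodule.eq_top_of_finrank_eq
    change Matrix.rank _ = _
    rw [h]; simp; ring
  have : Sum.elim u (Sum.elim d x) ∈
      LinearMap.range (Matrix.fromRows U (Matrix.fromRows D X)).mulVecLin := by
    rw [htop]; trivial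
  obtain ⟨g, hg⟩ := this
  rw [Matrix.mulVecLin_apply, Matrix.fromRows_mulVec, Matrix.fromRows_mulVec] at hg
  refine ⟨g, ?_, ?_, ?_⟩
  · simpa using congrArg (fun f => f ∘ Sum.inl) hg
  · exact congrArg (fun f => f ∘ Sum.inr ∘ Sum.inl) hg
  · exact congrArg (fun f => f ∘ Sum.inr ∘ Sum.inr) hg

lemma complex_ext {k l : ℕ} (M : Matrix (Fin k) (Fin l) ℝ) (v : Fin l → ℂ) (w : Fin k → ℂ)
    (h1 : M *ᵥ (fun i => (v i).re) = fun i => (w i).re)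
    (h2 : M *ᵥ (fun i => (v i).im) = fun i => (w i).im) : (M.map Complex.ofReal) *ᵥ v = w := by
  rw [← re_mulVec] at h1
  rw [← im_mulVec] at h2
  ext i
  exact Complex.ext (congrFun h1 i) (congrFun h2 i)

lemma rank_cond {n m p r N : ℕ}
    (A : Matrix (Fin n) (Fin n) ℝ) (B : Matrix (Fin n) (Fin m) ℝ)
    (E : Matrix (Fin n) (Fin r) ℝ) (C : Matrix (Fin p) (Fin n) ℝ)
    (U : Matrix (Fin m) (Fin N) ℝ) (D : Matrix (Fin r) (Fin N) ℝ)
    (X Xf : Matrix (Fin n) (Fin N) ℝ) (Y : Matrix (Fin p) (Fin N) ℝ)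
    (hX : Xf = A * X + B * U + E * D) (hY : Y = C * X)
    (hs : ∀ u d x, ∃ g, U *ᵥ g = u ∧ D *ᵥ g = d ∧ X *ᵥ g = x) (z : ℂ) :
    (Matrix.fromRows (z • X.map Complex.ofReal - Xf.map Complex.ofReal)
      (Matrix.fromRows (U.map Complex.ofReal) (Y.map Complex.ofReal))).rank = n + m + r ↔
    ∀ (x : Fin n → ℂ) (d : Fin r → ℂ),
      (A.map Complex.ofReal) *ᵥ x + (E.map Complex.ofReal) *ᵥ d = z • x →
      (C.map Complex.ofReal) *ᵥ x = 0 → x = 0 ∧ d = 0 := by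
  let Uc := U.map Complex.ofReal
  let Dc := D.map Complex.ofReal
  let Xc := X.map Complex.ofReal
  let Ac := A.map Complex.ofReal
  let Bc := B.map Complex.ofReal
  let Ec := E.map Complex.ofReal
  let Cc := C.map Complex.ofReal
  have hXc : Xf.map Complex.ofReal = Ac * Xc + Bc * Uc + Ec * Dc := by
    rw [hX]
    rw [Matrix.map_add _ (by simp), Matrix.map_add _ (by simp)]
    rw [map_mul_ofReal, map_mul_ofReal, map_mul_ofReal]
  have hYc : Y.map Complex.ofReal = Cc * Xc := by
    rw [hY, map_mul_ofReal]
  let Wc : (Fin N → ℂ) →ₗ[ℂ] (Fin n → ℂ) × (Fin m → ℂ) × (Fin r → ℂ) :=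
    Xc.mulVecLin.prod (Uc.mulVecLin.prod Dc.mulVecLin)
  have hW : Function.Surjective Wc := by
    rintro ⟨x, u, d⟩
    obtain ⟨g1, a1, b1, c1⟩ := hs (fun i => (u i).re) (fun i => (d i).re) (fun i => (x i).re)
    obtain ⟨g2, a2, b2, c2⟩ := hs (fun i => (u i).im) (fun i => (d i).im) (fun i => (x i).im)
    refine ⟨fun i => ⟨g1 i, g2 i⟩, ?_⟩
    exact Prod.ext (complex_ext X _ _ c1 c2)
      (Prod.ext (complex_ext U _ _ a1 a2) (complex_ext D _ _ b1 b2))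
  let J : (Fin n → ℂ) × (Fin m → ℂ) × (Fin r → ℂ) →ₗ[ℂ] (Fin n ⊕ (Fin m ⊕ Fin p) → ℂ) :=
    { toFun := fun q => Sum.elim (z • q.1 - (Ac *ᵥ q.1 + Bc *ᵥ q.2.1 + Ec *ᵥ q.2.2))
        (Sum.elim q.2.1 (Cc *ᵥ q.1))
      map_add' := by
        intro a b
        ext i
        rcases i with i | i | i <;> simp [Matrix.mulVec_add] ; ring
      map_smul' := by
        intro c a
        ext i
        rcases i with i | i | i <;> simp [Matrix.mulVec_smul] ; ring }
  have hJW : (Matrix.fromRows (z • X.map Complex.ofReal - Xf.map Complex.ofReal)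
      (Matrix.fromRows (U.map Complex.ofReal) (Y.map Complex.ofReal))).mulVecLin = J ∘ₗ Wc := by
    refine LinearMap.ext fun g => ?_
    rw [Matrix.mulVecLin_apply, hXc, hYc, Matrix.fromRows_mulVec, Matrix.fromRows_mulVec]
    change _ = Sum.elim (z • (Xc *ᵥ g) - (Ac *ᵥ (Xc *ᵥ g) + Bc *ᵥ (Uc *ᵥ g) + Ec *ᵥ (Dc *ᵥ g)))
        (Sum.elim (Uc *ᵥ g) (Cc *ᵥ (Xc *ᵥ g)))
    simp only [Matrix.sub_mulVec, Matrix.smul_mulVec, Matrix.add_mulVec, Matrix.mulVec_mulVec]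
    rfl
  have hrank : (Matrix.fromRows (z • X.map Complex.ofReal - Xf.map Complex.ofReal)
      (Matrix.fromRows (U.map Complex.ofReal) (Y.map Complex.ofReal))).rank =
      Module.finrank ℂ (LinearMap.range J) := by
    rw [Matrix.rank, hJW, LinearMap.range_comp_of_range_eq_top _ (LinearMap.range_eq_top.2 hW)]
  have hrn := LinearMap.finrank_range_add_finrank_ker J
  have hdim : Module.finrank ℂ ((Fin n → ℂ) × (Fin m → ℂ) × (Fin r → ℂ)) = n + m + r := by
    simp; ring
  rw [hdim] at hrn
  have hker : (Module.finrank ℂ (LinearMap.range J) = n + m + r) ↔ LinearMap.ker J = ⊥ := by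
    rw [← Submodule.finrank_eq_zero (R := ℂ)]; omega
  rw [hrank, hker, LinearMap.ker_eq_bot']
  constructor
  · intro h x d h1 h2
    have := h (x, 0, d) (by
      change Sum.elim (z • x - (Ac *ᵥ x + Bc *ᵥ 0 + Ec *ᵥ d)) (Sum.elim 0 (Cc *ᵥ x)) = 0
      rw [Matrix.mulVec_zero, add_zero, h1, h2, sub_self]
      ext i; rcases i with i | i | i <;> rfl)
    simp only [Prod.mk_eq_zero] at this
    exact ⟨this.1, this.2.2⟩
  · rintro h ⟨x, u, d⟩ hq
    change Sum.elim (z • x - (Ac *ᵥ x + Bc *ᵥ u + Ec *ᵥ d)) (Sum.elim u (Cc *ᵥ x)) = 0 at hq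
    have h1 := congrArg (fun f => f ∘ Sum.inl) hq
    have h2 := congrArg (fun f => f ∘ Sum.inr ∘ Sum.inl) hq
    have h3 := congrArg (fun f => f ∘ Sum.inr ∘ Sum.inr) hq
    change z • x - (Ac *ᵥ x + Bc *ᵥ u + Ec *ᵥ d) = 0 at h1
    change u = 0 at h2
    change Cc *ᵥ x = 0 at h3
    subst h2
    rw [Matrix.mulVec_zero, add_zero] at h1
    obtain ⟨rfl, rfl⟩ := h x d (sub_eq_zero.1 h1).symm h3
    rfl

lemma necessity_pbh {n m p r : ℕ}
    (A : Matrix (Fin n) (Fin n) ℝ) (B : Matrix (Fin n) (Fin m) ℝ)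
    (E : Matrix (Fin n) (Fin r) ℝ) (C : Matrix (Fin p) (Fin n) ℝ)
    (hE : ∀ d, E *ᵥ d = 0 → d = 0)
    (Auio : Matrix (Fin n) (Fin n) ℝ) (Bu : Matrix (Fin n) (Fin m) ℝ)
    (By Duio : Matrix (Fin n) (Fin p) ℝ) (h : IsUIO A B E C Auio Bu By Duio)
    (z : ℂ) (hz : 1 ≤ ‖z‖) (x : Fin n → ℂ) (d : Fin r → ℂ)
    (h1 : (A.map Complex.ofReal) *ᵥ x + (E.map Complex.ofReal) *ᵥ d = z • x)
    (h2 : (C.map Complex.ofReal) *ᵥ x = 0) : x = 0 ∧ d = 0 := by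
  have hstep : ∀ t : ℕ, (A.map Complex.ofReal) *ᵥ (z^t • x) + (E.map Complex.ofReal) *ᵥ (z^t • d)
      = z^(t+1) • x := by
    intro t
    rw [Matrix.mulVec_smul, Matrix.mulVec_smul, ← smul_add, h1, pow_succ, mul_smul]
  have hout : ∀ t : ℕ, (C.map Complex.ofReal) *ᵥ (z^t • x) = 0 := by
    intro t; rw [Matrix.mulVec_smul, h2, smul_zero]
  have obs : IsObsTraj Auio Bu By Duio (fun _ => 0) (fun _ => 0) (fun _ => 0) (fun _ => 0) := by
    intro t; simp
  have hre := h (fun _ => 0) (fun _ => 0) (fun t i => ((z^t • x) i).re)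
    (fun t i => ((z^t • d) i).re) _ _ (by
      intro t
      constructor
      · change (fun i => ((z^(t+1) • x) i).re) = _
        rw [← re_mulVec, ← re_mulVec, ← hstep t, Matrix.mulVec_zero, add_zero]; rfl
      · rw [← re_mulVec, hout]; rfl) obs
  have him := h (fun _ => 0) (fun _ => 0) (fun t i => ((z^t • x) i).im)
    (fun t i => ((z^t • d) i).im) _ _ (by
      intro t
      constructor
      · change (fun i => ((z^(t+1) • x) i).im) = _
        rw [← im_mulVec, ← im_mulVec, ← hstep t, Matrix.mulVec_zero, add_zero]; rfl
      · rw [← im_mulVec, hout]; rfl) obs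
  simp only [sub_zero] at hre him
  have hx : x = 0 := by
    ext i
    have e1 := tendsto_pi_nhds.1 hre i
    have e2 := tendsto_pi_nhds.1 him i
    have e3 := e1.abs.add e2.abs
    simp only [Pi.zero_apply, abs_zero, add_zero] at e3
    have : ‖x i‖ ≤ 0 := by
      refine ge_of_tendsto' e3 fun t => ?_
      have : ‖x i‖ ≤ ‖(z^t • x) i‖ := by
        rw [Pi.smul_apply, norm_smul, norm_pow]
        exact le_mul_of_one_le_left (norm_nonneg _) (one_le_pow₀ hz)
      exact this.trans (Complex.norm_le_abs_re_add_abs_im _)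
    simpa using this
  refine ⟨hx, ?_⟩
  subst hx
  rw [Matrix.mulVec_zero, zero_add, smul_zero] at h1
  have r1 := hE (fun i => (d i).re) (by rw [← re_mulVec, h1]; rfl)
  have r2 := hE (fun i => (d i).im) (by rw [← im_mulVec, h1]; rfl)
  ext i
  exact Complex.ext (congrFun r1 i) (congrFun r2 i)

lemma necessity_ce {n m p r : ℕ}
    (A : Matrix (Fin n) (Fin n) ℝ) (B : Matrix (Fin n) (Fin m) ℝ)
    (E : Matrix (Fin n) (Fin r) ℝ) (C : Matrix (Fin p) (Fin n) ℝ)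
    (Auio : Matrix (Fin n) (Fin n) ℝ) (Bu : Matrix (Fin n) (Fin m) ℝ)
    (By Duio : Matrix (Fin n) (Fin p) ℝ) (h : TSigma A B E C ⊆ TObs Auio Bu By Duio)
    (d : Fin r → ℝ) (hd : C *ᵥ (E *ᵥ d) = 0) : E *ᵥ d = 0 := by
  let ds : ℕ → Fin r → ℝ := fun t => Nat.casesOn t d (fun _ => 0)
  let xs : ℕ → Fin n → ℝ := fun t => Nat.rec 0 (fun k x => A *ᵥ x + E *ᵥ (ds k)) t
  have hx1 : xs 1 = E *ᵥ d := by
    change A *ᵥ 0 + E *ᵥ d = _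
    simp
  have hmem : ((fun _ => 0, fun t => C *ᵥ xs t, xs) :
      (ℕ → Fin m → ℝ) × (ℕ → Fin p → ℝ) × (ℕ → Fin n → ℝ)) ∈ TSigma A B E C := by
    refine ⟨ds, fun t => ⟨?_, rfl⟩⟩
    change A *ᵥ (xs t) + E *ᵥ (ds t) = A *ᵥ (xs t) + B *ᵥ 0 + E *ᵥ (ds t)
    simp
  obtain ⟨z, hz⟩ := h hmem
  have a0 := (hz 0).2
  have a1 := (hz 0).1
  have a2 := (hz 1).2
  change (0 : Fin n → ℝ) = z 0 + Duio *ᵥ (C *ᵥ (0 : Fin n → ℝ)) at a0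
  change z 1 = Auio *ᵥ (z 0) + Bu *ᵥ 0 + By *ᵥ (C *ᵥ (0 : Fin n → ℝ)) at a1
  change xs 1 = z 1 + Duio *ᵥ (C *ᵥ xs 1) at a2
  simp only [Matrix.mulVec_zero, add_zero] at a0 a1
  rw [hx1, hd, a1, ← a0] at a2
  simpa using a2

lemma sufficiency {n m p r : ℕ}
    (A : Matrix (Fin n) (Fin n) ℝ) (B : Matrix (Fin n) (Fin m) ℝ)
    (E : Matrix (Fin n) (Fin r) ℝ) (C : Matrix (Fin p) (Fin n) ℝ)
    (hCE : ∀ d, (C * E) *ᵥ d = 0 → d = 0)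
    (hP : ∀ z : ℂ, 1 ≤ ‖z‖ → ∀ (x : Fin n → ℂ) (d : Fin r → ℂ),
      (A.map Complex.ofReal) *ᵥ x + (E.map Complex.ofReal) *ᵥ d = z • x →
      (C.map Complex.ofReal) *ᵥ x = 0 → x = 0 ∧ d = 0) :
    ∃ (Auio : Matrix (Fin n) (Fin n) ℝ) (Bu : Matrix (Fin n) (Fin m) ℝ)
      (By Duio : Matrix (Fin n) (Fin p) ℝ),
      IsUIO A B E C Auio Bu By Duio ∧ TSigma A B E C ⊆ TObs Auio Bu By Duio := by
  obtain ⟨K, hK⟩ := exists_left_inv (C * E) hCE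
  let Q : Matrix (Fin n) (Fin n) ℝ := 1 - E * K * C
  have hQE : Q * E = 0 := by
    simp only [Q, Matrix.sub_mul, Matrix.one_mul, Matrix.mul_assoc, hK, Matrix.mul_one, sub_self]
  obtain ⟨L, hL⟩ := stabilize (Q * A) C (by
    intro l hl x h1 h2
    refine (hP l hl x (-((K * C * A).map Complex.ofReal *ᵥ x)) ?_ h2).1
    rw [← h1, Matrix.mulVec_neg, Matrix.mulVec_mulVec, ← sub_eq_add_neg, ← Matrix.sub_mulVec]
    congr 1
    rw [← map_mul_ofReal, ← Matrix.map_sub _ (by simp)]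
    simp only [Q, Matrix.sub_mul, Matrix.one_mul, Matrix.mul_assoc])
  let S := Q * A - L * C
  have hid : ∀ x : Fin n → ℝ, (Q * A) *ᵥ x
      = S *ᵥ (Q *ᵥ x) + (L + S * (E * K)) *ᵥ (C *ᵥ x) := by
    intro x
    rw [Matrix.mulVec_mulVec, Matrix.mulVec_mulVec, ← Matrix.add_mulVec]
    congr 1
    simp only [Matrix.add_mul, Q, Matrix.mul_sub, Matrix.mul_one, Matrix.mul_assoc]
    simp only [S, Q, Matrix.sub_mul, Matrix.one_mul, Matrix.mul_assoc]
    abel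
  have hstep : ∀ u y x d, IsSysTraj A B E C u y x d → ∀ t,
      Q *ᵥ (x (t+1)) = S *ᵥ (Q *ᵥ (x t)) + (Q * B) *ᵥ (u t) + (L + S * (E * K)) *ᵥ (y t) := by
    intro u y x d h t
    rw [(h t).1, (h t).2, Matrix.mulVec_add, Matrix.mulVec_add, Matrix.mulVec_mulVec,
      Matrix.mulVec_mulVec, Matrix.mulVec_mulVec _ Q E, hQE, hid, Matrix.zero_mulVec]
    abel
  have hQx : ∀ u y x d, IsSysTraj A B E C u y x d → ∀ t,
      x t - (E * K) *ᵥ (y t) = Q *ᵥ (x t) := by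
    intro u y x d h t
    rw [(h t).2, Matrix.mulVec_mulVec]
    simp only [Q, Matrix.sub_mulVec, Matrix.one_mulVec]
  refine ⟨S, Q * B, L + S * (E * K), E * K, ?_, ?_⟩
  · intro u y x d xh z hx hz
    have he : ∀ t, x t - xh t = Q *ᵥ (x t) - z t := by
      intro t
      rw [(hz t).2, ← hQx u y x d hx t]; abel
    have hpow : ∀ t, x t - xh t = (S^t) *ᵥ (x 0 - xh 0) := by
      intro t
      induction t with
      | zero => simp
      | succ t ih =>
        rw [pow_succ', ← Matrix.mulVec_mulVec, ← ih, he (t+1), he t, hstep u y x d hx, (hz t).1,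
          Matrix.mulVec_sub]
        abel
    exact (hL (x 0 - xh 0)).congr fun t => (hpow t).symm
  · rintro ⟨u, y, x⟩ ⟨d, hx⟩
    refine ⟨fun t => Q *ᵥ (x t), fun t => ⟨hstep u y x d hx t, ?_⟩⟩
    change x t = Q *ᵥ (x t) + (E * K) *ᵥ (y t)
    rw [← hQx u y x d hx t]; abel


/-- **Theorem 2.** Under the Assumption, there exists an unknown-input
observer `Σ̂` of the observer form for `Σ` with `T_Σ ⊆ T_Σ̂` if and only if
`ker X_f ⊇ ker [U_p; Y_p; Y_f; X_p]` and
`rank [z X_p - X_f; U_p; Y_p] = n + m + r` for all `z ∈ ℂ` with `|z| ≥ 1`. -/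
theorem statement14 {n m p r N : ℕ}
    (A : Matrix (Fin n) (Fin n) ℝ) (B : Matrix (Fin n) (Fin m) ℝ)
    (E : Matrix (Fin n) (Fin r) ℝ) (C : Matrix (Fin p) (Fin n) ℝ)
    (hE : E.rank = r)
    (ud : ℕ → Fin m → ℝ) (dd : ℕ → Fin r → ℝ) (xd : ℕ → Fin n → ℝ) (yd : ℕ → Fin p → ℝ)
    (hdata : GeneratedBy A B E C N ud dd xd yd)
    (hAssumption : (Matrix.fromRows (pastMat N ud)
      (Matrix.fromRows (pastMat N dd) (pastMat N xd))).rank = m + r + n) :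
    (∃ (Auio : Matrix (Fin n) (Fin n) ℝ) (Bu : Matrix (Fin n) (Fin m) ℝ)
      (By Duio : Matrix (Fin n) (Fin p) ℝ),
      IsUIO A B E C Auio Bu By Duio ∧ TSigma A B E C ⊆ TObs Auio Bu By Duio) ↔
    ((∀ g : Fin N → ℝ, (pastMat N ud).mulVec g = 0 → (pastMat N yd).mulVec g = 0 →
        (futMat N yd).mulVec g = 0 → (pastMat N xd).mulVec g = 0 →
        (futMat N xd).mulVec g = 0) ∧
      (∀ z : ℂ, 1 ≤ ‖z‖ →
        (Matrix.fromRows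
          (z • (pastMat N xd).map Complex.ofReal - (futMat N xd).map Complex.ofReal)
          (Matrix.fromRows ((pastMat N ud).map Complex.ofReal)
            ((pastMat N yd).map Complex.ofReal))).rank = n + m + r)) := by
  have hEinj : ∀ d, E *ᵥ d = 0 → d = 0 := by
    have hrn := LinearMap.finrank_range_add_finrank_ker E.mulVecLin
    change E.rank + _ = _ at hrn
    rw [hE, Module.finrank_fin_fun] at hrn
    have : LinearMap.ker E.mulVecLin = ⊥ := by
      rw [← Submodule.finrank_eq_zero (R := ℝ)]; omega
    exact LinearMap.ker_eq_bot'.1 this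
  have hs := surj_of_rank _ _ _ hAssumption
  have hX : futMat N xd = A * pastMat N xd + B * pastMat N ud + E * pastMat N dd := by
    ext i j
    exact congrFun (hdata.1 j.val j.isLt) i
  have hY : pastMat N yd = C * pastMat N xd := by
    ext i j
    exact congrFun (hdata.2 j.val j.isLt.le) i
  have hYf : futMat N yd = C * futMat N xd := by
    ext i j
    exact congrFun (hdata.2 (j.val + 1) j.isLt) i
  have hrank := rank_cond A B E C _ _ _ _ _ hX hY hs
  have hker : (∀ g : Fin N → ℝ, (pastMat N ud).mulVec g = 0 → (pastMat N yd).mulVec g = 0 →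
        (futMat N yd).mulVec g = 0 → (pastMat N xd).mulVec g = 0 →
        (futMat N xd).mulVec g = 0) ↔ ∀ d, C *ᵥ (E *ᵥ d) = 0 → E *ᵥ d = 0 := by
    have hXg : ∀ g, (pastMat N ud) *ᵥ g = 0 → (pastMat N xd) *ᵥ g = 0 →
        (futMat N xd) *ᵥ g = E *ᵥ ((pastMat N dd) *ᵥ g) := by
      intro g h1 h2
      rw [hX]
      simp only [Matrix.add_mulVec, ← Matrix.mulVec_mulVec, h1, h2, Matrix.mulVec_zero, zero_add]
    constructor
    · intro h d hd
      obtain ⟨g, h1, h2, h3⟩ := hs 0 d 0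
      have e := hXg g h1 h3
      rw [h2] at e
      rw [← e]
      refine h g h1 ?_ ?_ h3
      · rw [hY, ← Matrix.mulVec_mulVec, h3, Matrix.mulVec_zero]
      · rw [hYf, ← Matrix.mulVec_mulVec, e, hd]
    · intro h g h1 _ h3 h4
      have e := hXg g h1 h4
      rw [e]
      apply h
      rw [← e, Matrix.mulVec_mulVec, ← hYf, h3]
  rw [hker]
  constructor
  · rintro ⟨Au, Bu, By, Du, h1, h2⟩
    refine ⟨necessity_ce A B E C Au Bu By Du h2, fun z hz => (hrank z).2 ?_⟩
    exact necessity_pbh A B E C hEinj Au Bu By Du h1 z hz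
  · rintro ⟨h1, h2⟩
    refine sufficiency A B E C ?_ fun z hz => (hrank z).1 (h2 z hz)
    intro d hd
    rw [← Matrix.mulVec_mulVec] at hd
    exact hEinj d (h1 d hd)
end
end
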